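/- arXiv:1806.09875 — 2 statements merged into one kernel-verified Lean document; each statement's English description precedes it below -/
import Mathlib

section
/- Kubota's twisted 2-cocycle satisfies the cocycle identity A(α,β)·A(αβ,γ) = A(α,βγ)·A(β,γ) for all α, β, γ ∈ GL₂(ℤ). -/
open Matrix

noncomputable section

abbrev GL2Z := GL (Fin 2) ℤ

/-- The Hilbert symbol at the infinite place of `ℚ`:
`(a,b) = -1` if `a < 0` and `b < 0`, and `(a,b) = 1` otherwise. -/
def hilb (a b : ℚ) : ℤˣ := if a < 0 ∧ b < 0 then -1 else 1

/-- Kubota's function `χ`: for `γ = [[a,b],[c,d]]`, `χ(γ) = c` if `c ≠ 0`, else `χ(γ) = d`. -/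
def chi (γ : GL2Z) : ℤ :=
  if (γ : Matrix (Fin 2) (Fin 2) ℤ) 1 0 = 0 then (γ : Matrix (Fin 2) (Fin 2) ℤ) 1 1
  else (γ : Matrix (Fin 2) (Fin 2) ℤ) 1 0

/-- The determinant of an element of `GL₂(ℤ)`, as an integer. -/
def detZ (γ : GL2Z) : ℤ := ((γ : Matrix (Fin 2) (Fin 2) ℤ)).det

/-- Kubota's twisted 2-cocycle
`A(α,β) = (det α, det β)·(χ(αβ)/χ(α), χ(αβ)/(χ(β)·det α))`. -/
def KA (α β : GL2Z) : ℤˣ :=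
  hilb (detZ α) (detZ β) *
    hilb ((chi (α * β) : ℚ) / (chi α : ℚ))
      ((chi (α * β) : ℚ) / ((chi β : ℚ) * (detZ α : ℚ)))

/-- The matrix `R = [[-1,0],[0,1]]` as an element of `GL₂(ℤ)`. -/
def Rm : GL2Z :=
  ⟨!![-1, 0; 0, 1], !![-1, 0; 0, 1],
    by rw [Matrix.mul_fin_two, Matrix.one_fin_two]; norm_num,
    by rw [Matrix.mul_fin_two, Matrix.one_fin_two]; norm_num⟩

/-- `B(γ) = (χ(γ), χ(γR))`. -/
def KB (γ : GL2Z) : ℤˣ := hilb (chi γ) (chi (γ * Rm))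

/-- The first nonzero coordinate of an integer vector `(x, y)`, as used in `chi`. -/
def firstNonzero (x y : ℤ) : ℤ := if x = 0 then y else x

theorem firstNonzero_ne_zero {x y : ℤ} (h : x = 0 → y ≠ 0) : firstNonzero x y ≠ 0 := by
  unfold firstNonzero
  split_ifs with hx
  · exact h hx
  · exact hx

theorem firstNonzero_of_ne {x : ℤ} (y : ℤ) (h : x ≠ 0) : firstNonzero x y = x := by
  simp [firstNonzero, h]

theorem firstNonzero_mul {k : ℤ} (hk : k ≠ 0) (x y : ℤ) :
    firstNonzero (k * x) (k * y) = k * firstNonzero x y := by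
  unfold firstNonzero
  split_ifs <;> simp_all

/-- If `X` is one of `Y`, `-Z` or `Z = Y`, or `X + Z = Y`, then `X` and `Z` cannot share a sign
opposite to that of `Y`. -/
theorem not_signs_of_rel {X Y Z : ℤ} (h : X = Y ∨ Z = Y ∨ X = -Z ∨ X + Z = Y) :
    ¬(0 < X * Z ∧ X * Y < 0) := by
  rintro ⟨h₁, h₂⟩
  rcases h with h | h | h | h
  · rw [h] at h₂
    exact (mul_self_nonneg Y).not_gt h₂
  · rw [h] at h₁
    exact h₁.not_gt h₂
  · rw [h] at h₁
    nlinarith [mul_self_nonneg Z]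
  · rw [← h] at h₂
    nlinarith [mul_self_nonneg X]

/-- The sign constraint behind Kubota's cocycle identity: `(c, d)` is the bottom row of `α`,
and `β = [[p,q],[r,s]]`, `γ = [[t,u],[w,z]]`. -/
theorem firstNonzero_signs (c d p q r s t u w z : ℤ) (hα : c = 0 → d ≠ 0)
    (hβ : p * s - q * r ≠ 0) (hγ : t * z - u * w ≠ 0) :
    ¬(0 < (firstNonzero ((c * p + d * r) * t + (c * q + d * s) * w)
            ((c * p + d * r) * u + (c * q + d * s) * z) * firstNonzero r s) *
          (firstNonzero c d * firstNonzero w z * (p * s - q * r)) ∧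
      (firstNonzero ((c * p + d * r) * t + (c * q + d * s) * w)
            ((c * p + d * r) * u + (c * q + d * s) * z) * firstNonzero r s) *
          (firstNonzero (c * p + d * r) (c * q + d * s) *
            firstNonzero (r * t + s * w) (r * u + s * z)) < 0) := by
  apply not_signs_of_rel
  by_cases hc : c = 0
  · subst hc
    have e₁ := firstNonzero_mul (hα rfl) r s
    have e₂ := firstNonzero_mul (hα rfl) (r * t + s * w) (r * u + s * z)
    left
    simp only [zero_mul, zero_add]
    rw [e₁, show d * r * t + d * s * w = d * (r * t + s * w) by ring,
      show d * r * u + d * s * z = d * (r * u + s * z) by ring, e₂]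
    ring
  by_cases hr : r = 0
  · subst hr
    have hp : p ≠ 0 := by rintro rfl; simp at hβ
    have hs : s ≠ 0 := by rintro rfl; simp at hβ
    right; left
    simp only [zero_mul, zero_add, mul_zero, add_zero, sub_zero]
    rw [firstNonzero_mul hs, firstNonzero_of_ne _ (mul_ne_zero hc hp), firstNonzero_of_ne _ hc]
    ring
  rw [firstNonzero_of_ne d hc, firstNonzero_of_ne s hr]
  by_cases hm : c * p + d * r = 0
  · have hn : c * q + d * s ≠ 0 := by
      intro hn
      have : c * (p * s - q * r) = 0 := by linear_combination s * hm - r * hn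
      exact (mul_ne_zero hc hβ) this
    right; right; left
    simp only [hm, zero_mul, zero_add]
    rw [firstNonzero_mul hn]
    linear_combination firstNonzero w z * s * hm
  rw [firstNonzero_of_ne _ hm]
  by_cases hw : w = 0
  · subst hw
    have ht : t ≠ 0 := by rintro rfl; simp at hγ
    left
    simp only [mul_zero, add_zero]
    rw [firstNonzero_of_ne _ (mul_ne_zero hm ht), firstNonzero_of_ne _ (mul_ne_zero hr ht)]
    ring
  rw [firstNonzero_of_ne z hw]
  have hrel : ((c * p + d * r) * t + (c * q + d * s) * w) * r + c * w * (p * s - q * r) =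
      (c * p + d * r) * (r * t + s * w) := by ring
  by_cases hl : (c * p + d * r) * t + (c * q + d * s) * w = 0
  · rw [hl, zero_mul, zero_add] at hrel
    have hk : r * t + s * w ≠ 0 := by
      intro hk
      rw [hk, mul_zero] at hrel
      exact mul_ne_zero (mul_ne_zero hc hw) hβ hrel
    rw [firstNonzero_of_ne _ hk]
    exact Or.inr (Or.inl hrel)
  rw [firstNonzero_of_ne _ hl]
  by_cases hk : r * t + s * w = 0
  · rw [hk, mul_zero] at hrel
    exact Or.inr (Or.inr (Or.inl (by linear_combination hrel)))
  rw [firstNonzero_of_ne _ hk]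
  exact Or.inr (Or.inr (Or.inr hrel))

theorem detZ_ne_zero (γ : GL2Z) : detZ γ ≠ 0 :=
  ((Matrix.isUnit_iff_isUnit_det _).mp γ.isUnit).ne_zero

theorem detZ_mul (α β : GL2Z) : detZ (α * β) = detZ α * detZ β := by
  simp [detZ]

theorem chi_eq_firstNonzero (γ : GL2Z) : chi γ = firstNonzero (γ.val 1 0) (γ.val 1 1) := rfl

theorem bottom_row_ne_zero (γ : GL2Z) : γ.val 1 0 = 0 → γ.val 1 1 ≠ 0 := by
  intro h h'
  apply detZ_ne_zero γ
  simp [detZ, Matrix.det_fin_two, h, h']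

theorem chi_ne_zero (γ : GL2Z) : chi γ ≠ 0 :=
  firstNonzero_ne_zero (bottom_row_ne_zero γ)

theorem chi_signs (α β γ : GL2Z) :
    ¬(0 < (chi (α * β * γ) * chi β) * (chi α * chi γ * detZ β) ∧
      (chi (α * β * γ) * chi β) * (chi (α * β) * chi (β * γ)) < 0) := by
  have hβ := detZ_ne_zero β
  have hγ := detZ_ne_zero γ
  simp only [detZ, Matrix.det_fin_two] at hβ hγ
  simpa only [chi_eq_firstNonzero, detZ, Matrix.det_fin_two, Units.val_mul, Matrix.mul_apply,
    Fin.sum_univ_two] using firstNonzero_signs _ _ _ _ _ _ _ _ _ _ (bottom_row_ne_zero α) hβ hγ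

/-- The sign bit of an integer. -/
def negBit (x : ℤ) : Bool := decide (x < 0)

theorem negBit_mul {x y : ℤ} (hx : x ≠ 0) (hy : y ≠ 0) :
    negBit (x * y) = (negBit x ^^ negBit y) := by
  unfold negBit
  rcases lt_or_gt_of_ne hx with h | h <;> rcases lt_or_gt_of_ne hy with h' | h'
  · simp [h, h', (mul_pos_of_neg_of_neg h h').le]
  · simp [h, h'.le, mul_neg_of_neg_of_pos h h']
  · simp [h.le, h', mul_neg_of_pos_of_neg h h']
  · simp [h.not_gt, h'.not_gt, (mul_pos h h').not_gt]

theorem intCast_div_neg_iff (x y : ℤ) : (x : ℚ) / y < 0 ↔ negBit (x * y) = true := by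
  rw [negBit, decide_eq_true_iff, div_neg_iff, mul_neg_iff]
  norm_cast

theorem KA_eq_negBit (α β : GL2Z) :
    KA α β = (if negBit (detZ α) && negBit (detZ β) then -1 else 1) *
      (if (negBit (chi (α * β)) ^^ negBit (chi α)) &&
        (negBit (chi (α * β)) ^^ (negBit (chi β) ^^ negBit (detZ α))) then -1 else 1) := by
  have hα := chi_ne_zero α
  have hβ := chi_ne_zero β
  have hαβ := chi_ne_zero (α * β)
  have hd := detZ_ne_zero α
  have key := intCast_div_neg_iff (chi (α * β)) (chi β * detZ α)
  push_cast at key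
  simp only [KA, hilb, intCast_div_neg_iff, key, negBit_mul hαβ hα,
    negBit_mul hαβ (mul_ne_zero hβ hd), negBit_mul hβ hd, Bool.and_eq_true]
  simp [negBit]

theorem negBit_chi_signs (α β γ : GL2Z) :
    ¬((negBit (chi (α * β * γ)) ^^ negBit (chi β)) =
        ((negBit (chi α) ^^ negBit (chi γ)) ^^ negBit (detZ β)) ∧
      (negBit (chi (α * β * γ)) ^^ negBit (chi β)) ≠
        (negBit (chi (α * β)) ^^ negBit (chi (β * γ)))) := by
  have h := chi_signs α β γ
  have hX := mul_ne_zero (chi_ne_zero (α * β * γ)) (chi_ne_zero β)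
  have hac := mul_ne_zero (chi_ne_zero α) (chi_ne_zero γ)
  have hZ := mul_ne_zero hac (detZ_ne_zero β)
  have hY := mul_ne_zero (chi_ne_zero (α * β)) (chi_ne_zero (β * γ))
  rw [← negBit_mul (chi_ne_zero _) (chi_ne_zero _), ← negBit_mul (chi_ne_zero _) (chi_ne_zero _),
    ← negBit_mul hac (detZ_ne_zero β), ← negBit_mul (chi_ne_zero _) (chi_ne_zero _)]
  rintro ⟨h₁, h₂⟩
  refine h ⟨?_, ?_⟩
  · have := negBit_mul hX hZ
    rw [h₁, Bool.xor_self] at this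
    exact lt_of_le_of_ne (not_lt.mp (of_decide_eq_false this)) (mul_ne_zero hX hZ).symm
  · have := negBit_mul hX hY
    rw [Bool.xor_iff_ne.mpr h₂] at this
    exact of_decide_eq_true this

/-- Kubota's twisted 2-cocycle satisfies the cocycle identity
`A(α,β)·A(αβ,γ) = A(α,βγ)·A(β,γ)` for all `α, β, γ ∈ GL₂(ℤ)`. -/
theorem kubota_cocycle_identity (α β γ : GL2Z) :
    KA α β * KA (α * β) γ = KA α (β * γ) * KA β γ := by
  have h := negBit_chi_signs α β γ
  simp only [KA_eq_negBit, detZ_mul, negBit_mul (detZ_ne_zero _) (detZ_ne_zero _), ← mul_assoc α β γ]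
  generalize negBit (chi (α * β * γ)) = x at *
  generalize negBit (chi (α * β)) = y at *
  generalize negBit (chi (β * γ)) = y' at *
  generalize negBit (chi α) = a at *
  generalize negBit (chi β) = b at *
  generalize negBit (chi γ) = c at *
  generalize negBit (detZ α) = da at *
  generalize negBit (detZ β) = db at *
  generalize negBit (detZ γ) = dc at *
  revert x y y' a b c da db dc
  decide
end
end

section
/- For every γ ∈ SL₂(ℤ) one has A(R,γ)·A(Rγ,R) = −B(γ) and also A(R,γR)·A(γ,R) = −B(γ). -/
open Matrix

noncomputable section

theorem Rm_mul_apply_one (γ : GL2Z) (j : Fin 2) :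
    ((Rm * γ : GL2Z) : Matrix (Fin 2) (Fin 2) ℤ) 1 j = (γ : Matrix (Fin 2) (Fin 2) ℤ) 1 j := by
  simp [Rm, Matrix.mul_apply, Fin.sum_univ_two]

theorem chi_Rm_mul (γ : GL2Z) : chi (Rm * γ) = chi γ := by
  simp only [chi, Rm_mul_apply_one]

theorem mul_Rm_apply_zero (γ : GL2Z) (i : Fin 2) :
    ((γ * Rm : GL2Z) : Matrix (Fin 2) (Fin 2) ℤ) i 0 = -(γ : Matrix (Fin 2) (Fin 2) ℤ) i 0 := by
  simp [Rm, Matrix.mul_apply, Fin.sum_univ_two]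

theorem mul_Rm_apply_one (γ : GL2Z) (i : Fin 2) :
    ((γ * Rm : GL2Z) : Matrix (Fin 2) (Fin 2) ℤ) i 1 = (γ : Matrix (Fin 2) (Fin 2) ℤ) i 1 := by
  simp [Rm, Matrix.mul_apply, Fin.sum_univ_two]

theorem chi_Rm : chi Rm = 1 := by simp [chi, Rm]

theorem detZ_Rm : detZ Rm = -1 := by simp [detZ, Rm, Matrix.det_fin_two]

theorem chi_mul_Rm (γ : GL2Z) : chi (γ * Rm) = chi γ ∨ chi (γ * Rm) = -chi γ := by
  simp only [chi, mul_Rm_apply_zero, mul_Rm_apply_one, neg_eq_zero]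
  split_ifs <;> simp

/-- For every `γ ∈ SL₂(ℤ)`, `A(R,γ)·A(Rγ,R) = −B(γ)` and `A(R,γR)·A(γ,R) = −B(γ)`. -/
theorem KA_R_mul_KA_R_eq_neg_KB (γ : GL2Z) (hγ : detZ γ = 1) :
    KA Rm γ * KA (Rm * γ) Rm = -KB γ ∧ KA Rm (γ * Rm) * KA γ Rm = -KB γ := by
  have hx : (chi γ : ℚ) ≠ 0 := by exact_mod_cast chi_ne_zero γ
  simp only [KA, KB, mul_assoc Rm γ Rm, chi_Rm_mul, detZ_mul, detZ_Rm, chi_Rm, hγ]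
  rcases chi_mul_Rm γ with h | h <;> rw [h] <;> push_cast <;>
    rcases lt_or_gt_of_ne hx with hs | hs <;>
    simp [hilb, hx, hs, hs.not_gt, div_neg, (zero_lt_one (α := ℚ)).not_gt]
end
end
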